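/- Let n ≥ 1 and suppose the zero set D of H_n consists of n distinct real numbers. Then the weights λ_z = ∫ l_z dγ are strictly positive for every z ∈ D and they sum to one: Σ_{z∈D} λ_z = 1. In particular z ↦ λ_z is a discrete probability density on D. -/

import Mathlib

open MeasureTheory Polynomial ProbabilityTheory

/-- The probabilists' Hermite polynomials, defined by `H_0 = 1`, `H_1 = X` and the
three-term recurrence `H_{n+1}(x) = x·H_n(x) − n·H_{n−1}(x)`. -/
noncomputable def hermiteR : ℕ → Polynomial ℝ
  | 0 => 1
  | 1 => Polynomial.X
  | n + 2 => Polynomial.X * hermiteR (n + 1) - Polynomial.C ((n : ℝ) + 1) * hermiteR n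

lemma derivative_hermiteR_succ (n : ℕ) :
    derivative (hermiteR (n + 1)) = C ((n : ℝ) + 1) * hermiteR n := by
  induction n using Nat.twoStepInduction with
  | zero => simp [hermiteR]
  | one => simp [hermiteR]; ring
  | more n h₁ h₂ =>
    rw [hermiteR, derivative_sub, derivative_mul, derivative_C_mul, h₁, h₂, hermiteR]
    simp only [derivative_X, map_add, map_natCast, map_one, Nat.cast_add, Nat.cast_one]
    ring

lemma hermiteR_succ (n : ℕ) :
    hermiteR (n + 1) = X * hermiteR n - derivative (hermiteR n) := by
  cases n with
  | zero => simp [hermiteR]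
  | succ n => rw [derivative_hermiteR_succ, hermiteR]

lemma hermiteR_eq_map_hermite (n : ℕ) : hermiteR n = (hermite n).map (Int.castRingHom ℝ) := by
  induction n with
  | zero => simp [hermiteR]
  | succ n ih => simp [hermiteR_succ, hermite_succ, ih, derivative_map]

lemma hermiteR_monic (n : ℕ) : (hermiteR n).Monic := by
  rw [hermiteR_eq_map_hermite]
  exact (hermite_monic n).map _

lemma natDegree_hermiteR (n : ℕ) : (hermiteR n).natDegree = n := by
  rw [hermiteR_eq_map_hermite, (hermite_monic n).natDegree_map, natDegree_hermite]

lemma integrable_eval_gaussianReal (p : ℝ[X]) :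
    Integrable (fun x => p.eval x) (gaussianReal 0 1) := by
  induction p using Polynomial.induction_on' with
  | add p q hp hq =>
    simp only [eval_add]
    exact hp.add hq
  | monomial k a =>
    simp only [eval_monomial]
    refine Integrable.const_mul ?_ a
    have h := (memLp_id_gaussianReal (μ := 0) (v := 1) k).integrable_norm_pow'
    refine (integrable_norm_iff (by fun_prop)).1 ?_
    simpa using h

lemma integrable_gaussianPDFReal_mul_eval (p : ℝ[X]) :
    Integrable (fun x => gaussianPDFReal 0 1 x * p.eval x) := by
  have h := integrable_eval_gaussianReal p
  rw [gaussianReal_of_var_ne_zero 0 one_ne_zero,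
    integrable_withDensity_iff_integrable_smul' (measurable_gaussianPDF 0 1)
      (ae_of_all _ fun _ => gaussianPDF_lt_top)] at h
  simpa [toReal_gaussianPDF] using h

lemma hasDerivAt_gaussianPDFReal (x : ℝ) :
    HasDerivAt (gaussianPDFReal 0 1) (-x * gaussianPDFReal 0 1 x) x := by
  have h : HasDerivAt (fun y : ℝ => -(y - 0) ^ 2 / (2 * ((1 : NNReal) : ℝ))) (-x) x := by
    refine ((((hasDerivAt_id x).sub_const 0).pow 2).neg.div_const _).congr_deriv ?_
    simp
    ring
  exact (h.exp.const_mul (√(2 * Real.pi * ((1 : NNReal) : ℝ)))⁻¹).congr_deriv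
    (by rw [gaussianPDFReal]; ring)

/-- Stein's identity for polynomials. -/
lemma integral_X_mul_gaussianReal (p : ℝ[X]) :
    ∫ x, (X * p).eval x ∂(gaussianReal 0 1) = ∫ x, (derivative p).eval x ∂(gaussianReal 0 1) := by
  have h := integral_eq_zero_of_hasDerivAt_of_integrable
    (f := fun x => gaussianPDFReal 0 1 x * p.eval x)
    (f' := fun x => gaussianPDFReal 0 1 x * (derivative p - X * p).eval x)
    (fun x => ((hasDerivAt_gaussianPDFReal x).mul (p.hasDerivAt x)).congr_deriv
      (by simp; ring))
    (integrable_gaussianPDFReal_mul_eval _) (integrable_gaussianPDFReal_mul_eval _)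
  have h' : ∫ x, (derivative p - X * p).eval x ∂(gaussianReal 0 1) = 0 := by
    rw [integral_gaussianReal_eq_integral_smul one_ne_zero]
    simpa only [smul_eq_mul] using h
  simp only [eval_sub] at h'
  rw [integral_sub (integrable_eval_gaussianReal _) (integrable_eval_gaussianReal _)] at h'
  linarith

lemma integral_hermiteR_succ_mul (n : ℕ) (q : ℝ[X]) :
    ∫ x, (hermiteR (n + 1) * q).eval x ∂(gaussianReal 0 1) =
      ∫ x, (hermiteR n * derivative q).eval x ∂(gaussianReal 0 1) := by
  have e : hermiteR (n + 1) * q = X * (hermiteR n * q) - derivative (hermiteR n) * q := by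
    rw [hermiteR_succ]; ring
  simp only [e, eval_sub]
  rw [integral_sub (integrable_eval_gaussianReal _) (integrable_eval_gaussianReal _),
    integral_X_mul_gaussianReal, derivative_mul]
  simp only [eval_add]
  rw [integral_add (integrable_eval_gaussianReal _) (integrable_eval_gaussianReal _)]
  ring

lemma integral_hermiteR_mul_eq_zero {n : ℕ} {q : ℝ[X]} (hq : q.degree < n) :
    ∫ x, (hermiteR n * q).eval x ∂(gaussianReal 0 1) = 0 := by
  induction n generalizing q with
  | zero =>
    have : q = 0 := by simpa [Polynomial.degree_lt_iff_coeff_zero, Polynomial.ext_iff] using hq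
    simp [this]
  | succ n ih =>
    rw [integral_hermiteR_succ_mul]
    refine ih ?_
    rw [Polynomial.degree_lt_iff_coeff_zero] at hq ⊢
    intro m hm
    rw [coeff_derivative, hq (m + 1) (by omega), zero_mul]

lemma integral_mul_self_pos {p : ℝ[X]} (hp : p ≠ 0) :
    0 < ∫ x, (p * p).eval x ∂(gaussianReal 0 1) := by
  have : (gaussianReal 0 1).IsOpenPosMeasure :=
    (gaussianReal_absolutelyContinuous' 0 one_ne_zero).isOpenPosMeasure
  obtain ⟨x, hx⟩ : ∃ x, p.eval x ≠ 0 := by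
    by_contra! h
    exact hp (Polynomial.funext (by simpa using h))
  refine integral_pos_of_integrable_nonneg_nonzero (p * p).continuous
    (integrable_eval_gaussianReal _) (fun y => ?_) (x := x) ?_
  · simpa using mul_self_nonneg (p.eval y)
  · simpa using hx

/-- Gaussian quadrature: a polynomial of degree less than `2n` vanishing on the zeros of `H_n`
has zero Gaussian integral. -/
lemma integral_eq_zero_of_eval_zeros_eq_zero {n : ℕ} {D : Finset ℝ} (hcard : D.card = n)
    (hzero : ∀ x ∈ D, (hermiteR n).eval x = 0) {f : ℝ[X]} (hf : f.natDegree < n + n)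
    (hfD : ∀ x ∈ D, f.eval x = 0) : ∫ x, f.eval x ∂(gaussianReal 0 1) = 0 := by
  have hdiv := modByMonic_add_div f (hermiteR n)
  have hdeg : (hermiteR n).degree = n := by
    rw [degree_eq_natDegree (hermiteR_monic n).ne_zero, natDegree_hermiteR]
  have hr : f %ₘ hermiteR n = 0 := by
    refine eq_zero_of_degree_lt_of_eval_finset_eq_zero D ?_ fun x hx => ?_
    · rw [hcard, ← hdeg]
      exact degree_modByMonic_lt f (hermiteR_monic n)
    · have := congrArg (eval x) hdiv
      simpa [hzero x hx, hfD x hx] using this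
  rw [hr, zero_add] at hdiv
  rw [← hdiv]
  refine integral_hermiteR_mul_eq_zero (degree_le_natDegree.trans_lt ?_)
  rw [natDegree_divByMonic f (hermiteR_monic n), natDegree_hermiteR]
  exact_mod_cast (by omega : f.natDegree - n < n)

/-- The Gauss–Hermite cubature weights `λ_z = ∫ l_z dγ` are strictly
positive and sum to one, i.e. `z ↦ λ_z` is a discrete probability density on the zero set
`D` of `H_n`. -/
theorem hermite_quadrature_weights_probability
    (n : ℕ) (hn : 1 ≤ n)
    (D : Finset ℝ) (hcard : D.card = n)
    (hzero : ∀ x : ℝ, x ∈ D ↔ (hermiteR n).eval x = 0) :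
    (∀ z ∈ D, 0 < ∫ x, (Lagrange.basis D id z).eval x ∂(gaussianReal 0 1)) ∧
      ∑ z ∈ D, ∫ x, (Lagrange.basis D id z).eval x ∂(gaussianReal 0 1) = 1 := by
  have hinj : Set.InjOn (id : ℝ → ℝ) D := Function.injective_id.injOn
  refine ⟨fun z hz => ?_, ?_⟩
  · have hl : (Lagrange.basis D id z).natDegree = n - 1 := by
      rw [Lagrange.natDegree_basis hinj hz, hcard]
    have h := integral_eq_zero_of_eval_zeros_eq_zero hcard (fun x hx => (hzero x).1 hx)
      (f := Lagrange.basis D id z * Lagrange.basis D id z - Lagrange.basis D id z) (by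
        have h₁ := natDegree_sub_le (Lagrange.basis D id z * Lagrange.basis D id z)
          (Lagrange.basis D id z)
        have h₂ := natDegree_mul_le (p := Lagrange.basis D id z) (q := Lagrange.basis D id z)
        omega) (fun x hx => by
        rcases eq_or_ne z x with rfl | hzx
        · have := Lagrange.eval_basis_self hinj hz
          simp_all
        · have := Lagrange.eval_basis_of_ne (v := id) hzx hx
          simp_all)
    simp only [eval_sub] at h
    rw [integral_sub (integrable_eval_gaussianReal _) (integrable_eval_gaussianReal _)] at h
    linarith [integral_mul_self_pos (Lagrange.basis_ne_zero hinj hz)]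
  · have hD : D.Nonempty := Finset.card_pos.1 (by omega)
    rw [← integral_finsetSum _ fun z _ => integrable_eval_gaussianReal _]
    simp [← eval_finsetSum, Lagrange.sum_basis hinj hD]
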